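/- arXiv:2604.14671 — 4 statements merged into one kernel-verified Lean document; each statement's English description precedes it below -/
import Mathlib

section
/- For every integer q ≥ 1 and every set S ⊆ [q]^3, one has N_{4,2q}(L_q(S)) = 16·N_{4,q}(S). -/
/-- N_{4,q}(S): the number of quadruples (x₁,x₂,x₃,x₄) ∈ [q]⁴ with
(x₁,x₂,x₃) ∈ S and (x₂,x₃,x₄) ∉ S. -/
def N4 (q : ℕ) (S : Finset (Fin q × Fin q × Fin q)) : ℕ :=
  (Finset.univ.filter (fun x : Fin q × Fin q × Fin q × Fin q =>
    (x.1, x.2.1, x.2.2.1) ∈ S ∧ (x.2.1, x.2.2.1, x.2.2.2) ∉ S)).card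

/-- Halving map [2q] → [q], r ↦ ⌊r/2⌋. -/
def halfFin {q : ℕ} (x : Fin (2 * q)) : Fin q :=
  ⟨x.val / 2, by have := x.isLt; omega⟩

/-- The dyadic lift L_q(S) ⊆ [2q]³: (r,s,t) ∈ L_q(S) iff
(⌊r/2⌋,⌊s/2⌋,⌊t/2⌋) ∈ S. -/
def lift4 (q : ℕ) (S : Finset (Fin q × Fin q × Fin q)) :
    Finset (Fin (2 * q) × Fin (2 * q) × Fin (2 * q)) :=
  Finset.univ.filter (fun x => (halfFin x.1, halfFin x.2.1, halfFin x.2.2) ∈ S)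

/-- Every fibre of the halving map has two elements, at the level of sums. -/
theorem sum_comp_halfFin {M : Type*} [NonAssocSemiring M] {q : ℕ} (f : Fin q → M) :
    ∑ x : Fin (2 * q), f (halfFin x) = 2 * ∑ y, f y := by
  have h : ∑ p : Fin q × Fin 2, f p.1 = ∑ x : Fin (2 * q), f (halfFin x) := by
    refine Fintype.sum_equiv (finProdFinEquiv.trans (finCongr (mul_comm q 2))) _ _ fun p => ?_
    congr 1
    ext
    simp only [halfFin, Equiv.trans_apply, finCongr_apply, Fin.val_cast,
      finProdFinEquiv_apply_val]
    omega
  rw [← h, Fintype.sum_prod_type]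
  simp [Finset.mul_sum, two_mul]

theorem N4_eq_sum (q : ℕ) (S : Finset (Fin q × Fin q × Fin q)) :
    N4 q S = ∑ a, ∑ b, ∑ c, ∑ d, if (a, b, c) ∈ S ∧ (b, c, d) ∉ S then 1 else 0 := by
  simp only [N4, Finset.card_filter, Fintype.sum_prod_type]

/-- N_{4,2q}(L_q(S)) = 16·N_{4,q}(S). -/
theorem N4_lift4 (q : ℕ) (hq : 1 ≤ q) (S : Finset (Fin q × Fin q × Fin q)) :
    N4 (2 * q) (lift4 q S) = 16 * N4 q S := by
  simp only [N4_eq_sum, lift4, Finset.mem_filter, Finset.mem_univ, true_and]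
  let g (a b c d : Fin q) : ℕ := if (a, b, c) ∈ S ∧ (b, c, d) ∉ S then 1 else 0
  change ∑ a, ∑ b, ∑ c, ∑ d, g (halfFin a) (halfFin b) (halfFin c) (halfFin d) =
    16 * ∑ a, ∑ b, ∑ c, ∑ d, g a b c d
  have hd (a b c : Fin q) := sum_comp_halfFin (fun d => g a b c d)
  have hc (a b : Fin q) := sum_comp_halfFin (fun c => ∑ d, g a b c d)
  have hb (a : Fin q) := sum_comp_halfFin (fun b => ∑ c, ∑ d, g a b c d)
  have ha := sum_comp_halfFin (fun a => ∑ b, ∑ c, ∑ d, g a b c d)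
  simp only [hd, ← Finset.mul_sum, hc, hb, ha]
  ring
end

section
/- Let q ≥ 1, let S ⊆ [q]^3, and let a,b ∈ [q] with a ≠ b be such that H_q(a,b;S) holds. Let X := L_q(S) ⊆ [2q]^3 and let T := (X ∪ {P_1,P_2,P_3}) \ {M_1,M_2,M_3,M_4}, where P_1 = (2b,2b,2b+1), P_2 = (2b+1,2b,2b+1), P_3 = (2b+1,2a+1,2a), M_1 = (2a+1,2a,2a), M_2 = (2a+1,2a,2a+1), M_3 = (2b,2b+1,2a), M_4 = (2b,2b+1,2a+1). Then H_{2q}(2a+1, 2b+1; T) holds. -/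
/-- I_S(u,v) := #{x ∈ [q] : (x,u,v) ∈ S}. -/
def Ideg (q : ℕ) (S : Finset (Fin q × Fin q × Fin q)) (u v : Fin q) : ℕ :=
  (Finset.univ.filter (fun x : Fin q => (x, u, v) ∈ S)).card

/-- O_S(u,v) := #{c ∈ [q] : (u,v,c) ∈ S}. -/
def Odeg (q : ℕ) (S : Finset (Fin q × Fin q × Fin q)) (u v : Fin q) : ℕ :=
  (Finset.univ.filter (fun c : Fin q => (u, v, c) ∈ S)).card

/-- The local hypothesis H_q(a,b;S). -/
def Hq (q : ℕ) (a b : Fin q) (S : Finset (Fin q × Fin q × Fin q)) : Prop :=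
  (a, a, a) ∈ S ∧ (b, b, a) ∈ S ∧ (b, a, a) ∉ S ∧ (b, b, b) ∉ S ∧
  Ideg q S a a + Odeg q S a a = q ∧
  Ideg q S b b + Odeg q S b b = q ∧
  Ideg q S b b + Odeg q S b a = q - 1 ∧
  Ideg q S b a + Odeg q S a a = q + 1

/-- The element 2a of [2q]. -/
def dbl0 {q : ℕ} (a : Fin q) : Fin (2 * q) := ⟨2 * a.val, by have := a.isLt; omega⟩

/-- The element 2a+1 of [2q]. -/
def dbl1 {q : ℕ} (a : Fin q) : Fin (2 * q) := ⟨2 * a.val + 1, by have := a.isLt; omega⟩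

/-- The seven-site gadget modification T of the dyadic lift of S:
add P₁=(2b,2b,2b+1), P₂=(2b+1,2b,2b+1), P₃=(2b+1,2a+1,2a) and remove
M₁=(2a+1,2a,2a), M₂=(2a+1,2a,2a+1), M₃=(2b,2b+1,2a), M₄=(2b,2b+1,2a+1). -/
def gadget (q : ℕ) (a b : Fin q) (S : Finset (Fin q × Fin q × Fin q)) :
    Finset (Fin (2 * q) × Fin (2 * q) × Fin (2 * q)) :=
  (lift4 q S ∪
      {(dbl0 b, dbl0 b, dbl1 b), (dbl1 b, dbl0 b, dbl1 b), (dbl1 b, dbl1 a, dbl0 a)}) \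
    {(dbl1 a, dbl0 a, dbl0 a), (dbl1 a, dbl0 a, dbl1 a),
      (dbl0 b, dbl1 b, dbl0 a), (dbl0 b, dbl1 b, dbl1 a)}

theorem halfFin_dbl0 {q : ℕ} (a : Fin q) : halfFin (dbl0 a) = a := by
  ext; simp [halfFin, dbl0]

theorem halfFin_dbl1 {q : ℕ} (a : Fin q) : halfFin (dbl1 a) = a := by
  ext; simp only [halfFin, dbl1]; omega

theorem dbl0_ne_dbl1 {q : ℕ} (a b : Fin q) : dbl0 a ≠ dbl1 b := by
  intro h
  have := congrArg Fin.val h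
  simp only [dbl0, dbl1] at this
  omega

theorem dbl1_inj {q : ℕ} {a b : Fin q} : dbl1 a = dbl1 b ↔ a = b :=
  ⟨fun h => by rw [← halfFin_dbl1 a, h, halfFin_dbl1], fun h => h ▸ rfl⟩

theorem eq_dbl0_or_eq_dbl1 {q : ℕ} (x : Fin (2 * q)) :
    x = dbl0 (halfFin x) ∨ x = dbl1 (halfFin x) := by
  simp only [Fin.ext_iff, dbl0, dbl1, halfFin]
  omega

/-- Every element of `[q]` has exactly two preimages under halving. -/
theorem card_filter_halfFin {q : ℕ} (p : Fin q → Prop) [DecidablePred p] :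
    (Finset.univ.filter (fun x : Fin (2 * q) => p (halfFin x))).card =
      2 * (Finset.univ.filter p).card := by
  have key : Finset.univ.filter (fun x : Fin (2 * q) => p (halfFin x)) =
      (Finset.univ.filter p).image dbl0 ∪ (Finset.univ.filter p).image dbl1 := by
    ext x
    simp only [Finset.mem_filter, Finset.mem_univ, true_and, Finset.mem_union, Finset.mem_image]
    constructor
    · intro h
      exact (eq_dbl0_or_eq_dbl1 x).imp (fun e => ⟨_, h, e.symm⟩) (fun e => ⟨_, h, e.symm⟩)
    · rintro (⟨y, hy, rfl⟩ | ⟨y, hy, rfl⟩)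
      · rwa [halfFin_dbl0]
      · rwa [halfFin_dbl1]
  rw [key, Finset.card_union_of_disjoint, Finset.card_image_of_injective,
    Finset.card_image_of_injective, two_mul]
  · exact fun _ _ => dbl1_inj.1
  · exact Function.LeftInverse.injective halfFin_dbl0
  · simp only [Finset.disjoint_left, Finset.mem_image]
    rintro _ ⟨y, -, rfl⟩ ⟨z, -, h⟩
    exact dbl0_ne_dbl1 y z h.symm

theorem mem_lift4 {q : ℕ} {S : Finset (Fin q × Fin q × Fin q)} {x y z : Fin (2 * q)} :
    (x, y, z) ∈ lift4 q S ↔ (halfFin x, halfFin y, halfFin z) ∈ S := by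
  simp [lift4]

theorem Ideg_lift4 (q : ℕ) (S : Finset (Fin q × Fin q × Fin q)) (u v : Fin (2 * q)) :
    Ideg (2 * q) (lift4 q S) u v = 2 * Ideg q S (halfFin u) (halfFin v) := by
  simp only [Ideg, mem_lift4]
  exact card_filter_halfFin (fun x => (x, halfFin u, halfFin v) ∈ S)

theorem Odeg_lift4 (q : ℕ) (S : Finset (Fin q × Fin q × Fin q)) (u v : Fin (2 * q)) :
    Odeg (2 * q) (lift4 q S) u v = 2 * Odeg q S (halfFin u) (halfFin v) := by
  simp only [Odeg, mem_lift4]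
  exact card_filter_halfFin (fun x => (halfFin u, halfFin v, x) ∈ S)

theorem mem_gadget {q : ℕ} {a b : Fin q} {S : Finset (Fin q × Fin q × Fin q)}
    {x y z : Fin (2 * q)} :
    (x, y, z) ∈ gadget q a b S ↔
      ((x, y, z) ∈ lift4 q S ∨ (x = dbl0 b ∧ y = dbl0 b ∧ z = dbl1 b) ∨
        (x = dbl1 b ∧ y = dbl0 b ∧ z = dbl1 b) ∨ (x = dbl1 b ∧ y = dbl1 a ∧ z = dbl0 a)) ∧
      ¬((x = dbl1 a ∧ y = dbl0 a ∧ z = dbl0 a) ∨ (x = dbl1 a ∧ y = dbl0 a ∧ z = dbl1 a) ∨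
        (x = dbl0 b ∧ y = dbl1 b ∧ z = dbl0 a) ∨ (x = dbl0 b ∧ y = dbl1 b ∧ z = dbl1 a)) := by
  simp only [gadget, Finset.mem_sdiff, Finset.mem_union, Finset.mem_insert,
    Finset.mem_singleton, Prod.mk.injEq]

/-- under H_q(a,b;S) with a ≠ b, the gadget set T satisfies
H_{2q}(2a+1, 2b+1; T). -/
theorem Hq_gadget (q : ℕ) (hq : 1 ≤ q) (S : Finset (Fin q × Fin q × Fin q))
    (a b : Fin q) (hab : a ≠ b) (hH : Hq q a b S) :
    Hq (2 * q) (dbl1 a) (dbl1 b) (gadget q a b S) := by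
  obtain ⟨haaa, hbba, hbaa, hbbb, h₁, h₂, h₃, h₄⟩ := hH
  have h10 (c d : Fin q) : dbl1 c ≠ dbl0 d := (dbl0_ne_dbl1 d c).symm
  have Iaa : Ideg (2 * q) (gadget q a b S) (dbl1 a) (dbl1 a) = 2 * Ideg q S a a := by
    have hlift := Ideg_lift4 q S (dbl1 a) (dbl1 a)
    rw [halfFin_dbl1] at hlift
    rw [← hlift]
    simp [Ideg, mem_gadget, h10, dbl1_inj, hab]
  have Oaa : Odeg (2 * q) (gadget q a b S) (dbl1 a) (dbl1 a) = 2 * Odeg q S a a := by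
    have hlift := Odeg_lift4 q S (dbl1 a) (dbl1 a)
    rw [halfFin_dbl1] at hlift
    rw [← hlift]
    simp [Odeg, mem_gadget, h10, dbl1_inj, hab]
  have Ibb : Ideg (2 * q) (gadget q a b S) (dbl1 b) (dbl1 b) = 2 * Ideg q S b b := by
    have hlift := Ideg_lift4 q S (dbl1 b) (dbl1 b)
    rw [halfFin_dbl1] at hlift
    rw [← hlift]
    simp [Ideg, mem_gadget, h10, dbl1_inj, hab.symm]
  have Obb : Odeg (2 * q) (gadget q a b S) (dbl1 b) (dbl1 b) = 2 * Odeg q S b b := by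
    have hlift := Odeg_lift4 q S (dbl1 b) (dbl1 b)
    rw [halfFin_dbl1] at hlift
    rw [← hlift]
    simp [Odeg, mem_gadget, h10, dbl1_inj, hab.symm]
  have Oba : Odeg (2 * q) (gadget q a b S) (dbl1 b) (dbl1 a) = 2 * Odeg q S b a + 1 := by
    have hlift := Odeg_lift4 q S (dbl1 b) (dbl1 a)
    rw [halfFin_dbl1, halfFin_dbl1] at hlift
    rw [← hlift, Odeg, Odeg, ← Finset.card_insert_of_notMem (a := dbl0 a)]
    · congr 1
      ext z
      simp [mem_gadget, h10, or_comm]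
    · simpa [mem_lift4, halfFin_dbl0, halfFin_dbl1] using hbaa
  have Iba : Ideg (2 * q) (gadget q a b S) (dbl1 b) (dbl1 a) + 1 = 2 * Ideg q S b a := by
    have hlift := Ideg_lift4 q S (dbl1 b) (dbl1 a)
    rw [halfFin_dbl1, halfFin_dbl1] at hlift
    rw [← hlift, Ideg, Ideg, ← Finset.card_erase_add_one
      (s := Finset.univ.filter fun x => (x, dbl1 b, dbl1 a) ∈ lift4 q S) (a := dbl0 b)]
    · congr 2
      ext x
      simp [mem_gadget, h10, dbl1_inj, hab, and_comm]
    · simpa [mem_lift4, halfFin_dbl0, halfFin_dbl1] using hbba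
  refine ⟨?_, ?_, ?_, ?_, by omega, by omega, by omega, by omega⟩ <;>
    simp [mem_gadget, mem_lift4, halfFin_dbl1, h10, haaa, hbba, hbaa, hbbb]
end

section
/- Let k be an odd prime, let x ∈ {0,1}^k be a non-constant binary word, let J_k := {1, 3, 5, …, k−2} ⊆ ℤ/kℤ, and let t ∈ ℤ/kℤ. Then the set A_t := {ρ^{t+r}(x) : r ∈ J_k} is an independent set in the simple graph underlying B(k,2) and has cardinality (k−1)/2. -/
/-- The length-(k-1) suffix of `u` equals the length-(k-1) prefix of `v`. -/
def shifts (k q : ℕ) (u v : Fin k → Fin q) : Prop :=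
  ∀ i : ℕ, (h : i + 1 < k) → u ⟨i + 1, h⟩ = v ⟨i, by omega⟩

/-- Adjacency in the simple graph underlying the de Bruijn graph B(k,q). -/
def dbAdj (k q : ℕ) (u v : Fin k → Fin q) : Prop :=
  u ≠ v ∧ (shifts k q u v ∨ shifts k q v u)

/-- The cyclic left rotation ρ on words of length k. -/
def rotate (k q : ℕ) (x : Fin k → Fin q) : Fin k → Fin q :=
  fun i => x ⟨(i.val + 1) % k, Nat.mod_lt _ (by have := i.isLt; omega)⟩

/-- J_k = {1, 3, 5, …, k−2} ⊆ ℤ/kℤ, the odd residues up to k−2. -/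
def Jset (k : ℕ) : Set (ZMod k) :=
  {r | ∃ a : ℕ, Odd a ∧ a ≤ k - 2 ∧ r = (a : ZMod k)}

/-- The word `x` extended to a `k`-periodic sequence, indexed by residues. -/
def cyclicWord {k q : ℕ} [NeZero k] (x : Fin k → Fin q) (z : ZMod k) : Fin q :=
  x ⟨z.val, z.val_lt⟩

lemma rotate_iterate_apply {k q : ℕ} [NeZero k] (x : Fin k → Fin q) (n : ℕ) (i : Fin k) :
    (rotate k q)^[n] x i = cyclicWord x ((n : ZMod k) + (i.val : ZMod k)) := by
  induction n generalizing i with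
  | zero => simp [cyclicWord, ZMod.val_natCast, Nat.mod_eq_of_lt i.isLt]
  | succ n ih =>
    rw [Function.iterate_succ_apply', rotate, ih]
    simp only [ZMod.natCast_mod]
    push_cast
    congr 1
    ring

lemma rotate_iterate_val_apply {k q : ℕ} [NeZero k] (x : Fin k → Fin q) (a : ZMod k)
    (i : Fin k) :
    (rotate k q)^[a.val] x i = cyclicWord x (a + (i.val : ZMod k)) := by
  rw [rotate_iterate_apply, ZMod.natCast_zmod_val]

lemma cyclicWord_translate_injective {k q : ℕ} [Fact k.Prime] {x : Fin k → Fin q}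
    (hx : ¬ ∃ c : Fin q, ∀ i, x i = c) {a b : ZMod k}
    (h : ∀ z, cyclicWord x (a + z) = cyclicWord x (b + z)) : a = b := by
  by_contra hab
  have hd : b - a ≠ 0 := sub_ne_zero.mpr (Ne.symm hab)
  have hstep : ∀ z, cyclicWord x (z + (b - a)) = cyclicWord x z := fun z => by
    have := h (z - a)
    rw [add_sub_cancel] at this
    rw [this]
    congr 1
    ring
  have hmul : ∀ n : ℕ, cyclicWord x ((n : ZMod k) * (b - a)) = cyclicWord x 0 := fun n => by
    induction n with
    | zero => simp
    | succ n ih => rw [← ih, ← hstep ((n : ZMod k) * (b - a))]; congr 1; push_cast; ring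
  refine hx ⟨cyclicWord x 0, fun i => ?_⟩
  have := hmul ((i.val : ZMod k) / (b - a)).val
  rw [ZMod.natCast_zmod_val, div_mul_cancel₀ _ hd] at this
  rw [← this]
  simp [cyclicWord, ZMod.val_natCast, Nat.mod_eq_of_lt i.isLt]

lemma rotate_iterate_val_injective {k q : ℕ} [Fact k.Prime] {x : Fin k → Fin q}
    (hx : ¬ ∃ c : Fin q, ∀ i, x i = c) :
    Function.Injective fun a : ZMod k => (rotate k q)^[a.val] x := by
  intro a b hab
  refine cyclicWord_translate_injective hx fun z => ?_
  have := congrFun hab ⟨z.val, z.val_lt⟩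
  simpa only [rotate_iterate_val_apply, ZMod.natCast_zmod_val] using this

/-- Among rotations of a fixed non-constant word of prime length, the only possible
successor of a rotation in the de Bruijn graph is the next rotation. -/
lemma eq_add_one_of_shifts_rotate_iterate {k q : ℕ} [Fact k.Prime] {x : Fin k → Fin q}
    (hx : ¬ ∃ c : Fin q, ∀ i, x i = c) {a b : ZMod k}
    (h : shifts k q ((rotate k q)^[a.val] x) ((rotate k q)^[b.val] x)) : b = a + 1 := by
  have hne : ∀ z : ZMod k, z ≠ -1 → cyclicWord x (b + z) = cyclicWord x (a + 1 + z) := by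
    intro z hz
    have hlt : z.val + 1 < k := by
      refine lt_of_le_of_ne z.val_lt fun hk => hz ?_
      have := congrArg (Nat.cast : ℕ → ZMod k) hk
      rw [Nat.cast_add, ZMod.natCast_zmod_val, ZMod.natCast_self, Nat.cast_one] at this
      exact eq_neg_of_add_eq_zero_left this
    have := h z.val hlt
    simp only [rotate_iterate_val_apply, Nat.cast_add, ZMod.natCast_zmod_val, Nat.cast_one]
      at this
    rw [← this]
    congr 1
    ring
  have hsum : ∀ c : ZMod k,
      ∑ z, (cyclicWord x (c + z)).val = ∑ z, (cyclicWord x z).val := fun c =>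
    Equiv.sum_comp (Equiv.addLeft c) fun z => (cyclicWord x z).val
  have hlast : cyclicWord x (b + -1) = cyclicWord x (a + 1 + -1) := by
    have hb := hsum b
    rw [← hsum (a + 1), ← Finset.add_sum_erase _ _ (Finset.mem_univ (-1 : ZMod k)),
      ← Finset.add_sum_erase _ _ (Finset.mem_univ (-1 : ZMod k)),
      Finset.sum_congr rfl fun z hz => by rw [hne z (Finset.ne_of_mem_erase hz)]] at hb
    exact Fin.ext (Nat.add_right_cancel hb)
  refine cyclicWord_translate_injective hx fun z => ?_
  by_cases hz : z = -1
  · rw [hz, hlast]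
  · exact hne z hz

lemma add_one_notMem_Jset {k : ℕ} (hk : 2 ≤ k) {r : ZMod k} (hr : r ∈ Jset k) :
    r + 1 ∉ Jset k := by
  rintro ⟨b, hb, hbk, hrb⟩
  obtain ⟨a, ha, hak, rfl⟩ := hr
  have h : ((a + 1 : ℕ) : ZMod k) = (b : ℕ) := by rw [← hrb]; push_cast; rfl
  rw [ZMod.natCast_eq_natCast_iff', Nat.mod_eq_of_lt (by omega),
    Nat.mod_eq_of_lt (by omega)] at h
  subst h
  exact (Nat.not_odd_iff_even.mpr ha.add_one) hb

lemma ncard_Jset {k : ℕ} (hk : 2 ≤ k) (hkodd : Odd k) : (Jset k).ncard = (k - 1) / 2 := by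
  have himage : Jset k =
      ((Finset.range ((k - 1) / 2)).image fun a => ((2 * a + 1 : ℕ) : ZMod k) :
        Finset (ZMod k)) := by
    obtain ⟨m, rfl⟩ := hkodd
    ext r
    simp only [Jset, Set.mem_ofPred_eq, Finset.coe_image, Set.mem_image, Finset.mem_coe,
      Finset.mem_range]
    constructor
    · rintro ⟨_, ⟨a, rfl⟩, ha, rfl⟩
      exact ⟨a, by omega, rfl⟩
    · rintro ⟨a, ha, rfl⟩
      exact ⟨2 * a + 1, ⟨a, rfl⟩, by omega, rfl⟩
  rw [himage, Set.ncard_coe_finset, Finset.card_image_of_injOn, Finset.card_range]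
  intro a ha b hb hab
  simp only [Finset.coe_range, Set.mem_Iio] at ha hb
  simp only [ZMod.natCast_eq_natCast_iff'] at hab
  rw [Nat.mod_eq_of_lt (by omega), Nat.mod_eq_of_lt (by omega)] at hab
  omega

/-- for an odd prime k, a non-constant binary word x of length k
and any phase t ∈ ℤ/kℤ, the set A_t = {ρ^{t+r}(x) : r ∈ J_k} is independent
in the simple graph underlying B(k,2) and has cardinality (k−1)/2. -/
theorem alternating_phase_set_indep (k : ℕ) (hk : k.Prime) (hkodd : Odd k)
    (x : Fin k → Fin 2) (hx : ¬ ∃ c : Fin 2, ∀ i, x i = c) (t : ZMod k) :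
    (∀ u ∈ (fun r : ZMod k => (rotate k 2)^[(t + r).val] x) '' Jset k,
      ∀ v ∈ (fun r : ZMod k => (rotate k 2)^[(t + r).val] x) '' Jset k,
        ¬ dbAdj k 2 u v) ∧
    ((fun r : ZMod k => (rotate k 2)^[(t + r).val] x) '' Jset k).ncard = (k - 1) / 2 := by
  have : Fact k.Prime := ⟨hk⟩
  have hnot : ∀ r ∈ Jset k, ∀ s ∈ Jset k,
      ¬ shifts k 2 ((rotate k 2)^[(t + r).val] x) ((rotate k 2)^[(t + s).val] x) := by
    intro r hr s hs h
    have hsr := eq_add_one_of_shifts_rotate_iterate hx h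
    rw [add_assoc, add_right_inj] at hsr
    exact add_one_notMem_Jset hk.two_le hr (hsr ▸ hs)
  constructor
  · rintro _ ⟨r, hr, rfl⟩ _ ⟨s, hs, rfl⟩ ⟨-, h | h⟩
    · exact hnot r hr s hs h
    · exact hnot s hs r hr h
  · rw [← ncard_Jset hk.two_le hkodd]
    exact Set.ncard_image_of_injective _
      ((rotate_iterate_val_injective hx).comp (add_right_injective t))
end

section
/- One has α(13,2) = 3781; more precisely, the maximum cardinality of an independent set in the simple graph underlying the de Bruijn graph B(13,2) equals 3781, and this maximum is attained by an independent set that contains the constant word 0^13 and does not contain the constant word 1^13. -/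
/-- A finset of words is independent if no two of its elements are adjacent. -/
def IsIndep (k q : ℕ) (I : Finset (Fin k → Fin q)) : Prop :=
  ∀ u ∈ I, ∀ v ∈ I, ¬ dbAdj k q u v

/-- The independence number α(k,q) of the simple graph underlying B(k,q). -/
noncomputable def alphaDB (k q : ℕ) : ℕ :=
  sSup {n | ∃ I : Finset (Fin k → Fin q), IsIndep k q I ∧ I.card = n}

namespace DeBruijn

/-- The cyclic rotation of a 13-letter binary word, the word `u` being coded as `∑ uᵢ 2ⁱ`. -/
def rot (n : ℕ) : ℕ := n / 2 + n % 2 * 4096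

/-- Independence of a set of coded 13-letter binary words. -/
def CodeIndep (J : Finset ℕ) : Prop :=
  ∀ a ∈ J, ∀ b ∈ J, a ≠ b → b % 4096 ≠ a / 2

/-- The code `∑ uᵢ 2ⁱ` of a word. -/
def code (u : Fin 13 → Fin 2) : ℕ := (finFunctionFinEquiv u : Fin (2 ^ 13))

lemma code_lt (u : Fin 13 → Fin 2) : code u < 8192 := (finFunctionFinEquiv u).isLt

lemma code_injective : Function.Injective code := fun _ _ h =>
  finFunctionFinEquiv.injective (Fin.ext h)

lemma exists_code_eq {n : ℕ} (hn : n < 8192) : ∃ u, code u = n :=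
  ⟨finFunctionFinEquiv.symm (⟨n, hn⟩ : Fin (2 ^ 13)), by simp [code]⟩

lemma apply_eq_code (u : Fin 13 → Fin 2) (i : Fin 13) :
    (u i : ℕ) = code u / 2 ^ (i : ℕ) % 2 := by
  conv_lhs => rw [← finFunctionFinEquiv.symm_apply_apply u]
  rfl

lemma shifts_iff (u v : Fin 13 → Fin 2) :
    shifts 13 2 u v ↔ code v % 4096 = code u / 2 := by
  constructor
  · intro h
    have e : ∀ i : ℕ, (hi : i + 1 < 13) →
        (u ⟨i + 1, hi⟩ : ℕ) = (v ⟨i, by omega⟩ : ℕ) := fun i hi => congrArg _ (h i hi)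
    have hu := (u 0).isLt
    have hv : ∀ i, (v i : ℕ) < 2 := fun i => (v i).isLt
    simp only [code, finFunctionFinEquiv_apply, Fin.sum_univ_succ, Fin.sum_univ_zero]
    have := e 0; have := e 1; have := e 2; have := e 3; have := e 4; have := e 5
    have := e 6; have := e 7; have := e 8; have := e 9; have := e 10; have := e 11
    have := hv 0; have := hv 1; have := hv 2; have := hv 3; have := hv 4; have := hv 5
    have := hv 6; have := hv 7; have := hv 8; have := hv 9; have := hv 10; have := hv 11
    simp_all [Fin.succ]
    omega
  · intro h i hi
    apply Fin.ext
    rw [apply_eq_code, apply_eq_code]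
    have hlt := code_lt u
    have hi' : i < 12 := by omega
    show code u / 2 ^ (i + 1) % 2 = code v / 2 ^ i % 2
    rw [pow_succ', ← Nat.div_div_eq_div_mul, ← h]
    interval_cases i <;> omega

/-- `p` holds at all of `a, …, a + 2 ^ d - 1`. -/
def allFrom (p : ℕ → Bool) : ℕ → ℕ → Bool
  | 0, a => p a
  | d + 1, a => allFrom p d a && allFrom p d (a + 2 ^ d)

/-- The number of elements of `a, …, a + 2 ^ d - 1` at which `p` holds. -/
def countFrom (p : ℕ → Bool) : ℕ → ℕ → ℕ
  | 0, a => (p a).toNat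
  | d + 1, a => countFrom p d a + countFrom p d (a + 2 ^ d)

lemma of_allFrom (p : ℕ → Bool) (d a n : ℕ) (h : allFrom p d a = true)
    (han : a ≤ n) (hn : n < a + 2 ^ d) : p n = true := by
  induction d generalizing a with
  | zero =>
    obtain rfl : n = a := by simp at hn; omega
    exact h
  | succ d ih =>
    simp only [allFrom, Bool.and_eq_true] at h
    rw [pow_succ] at hn
    by_cases hc : n < a + 2 ^ d
    · exact ih a h.1 han hc
    · exact ih _ h.2 (by omega) (by omega)

lemma countFrom_eq_sum (p : ℕ → Bool) (d a : ℕ) :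
    countFrom p d a = ∑ i ∈ Finset.range (2 ^ d), (p (a + i)).toNat := by
  induction d generalizing a with
  | zero => simp [countFrom]
  | succ d ih =>
    rw [countFrom, ih, ih, pow_succ, mul_two, Finset.sum_range_add]
    simp [add_assoc]

lemma rot_iterate_period {n : ℕ} (hn : n < 8192) : rot^[13] n = n := by
  have h : allFrom (fun n => rot^[13] n == n) 13 0 = true := by decide +kernel
  simpa using of_allFrom _ 13 0 n h (by omega) (by omega)

lemma sum_rot (c : ℕ → ℕ) :
    ∑ n ∈ Finset.range 8192, c (rot n) = ∑ n ∈ Finset.range 8192, c n := by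
  refine Finset.sum_nbij' rot (fun n => n % 4096 * 2 + n / 4096) ?_ ?_ ?_ ?_ ?_ <;>
    intro n hn <;> simp only [Finset.mem_range, rot] at * <;> omega

lemma sum_rot_iterate (c : ℕ → ℕ) (i : ℕ) :
    ∑ n ∈ Finset.range 8192, c (rot^[i] n) = ∑ n ∈ Finset.range 8192, c n := by
  induction i with
  | zero => rfl
  | succ i ih =>
    simp only [Function.iterate_succ_apply]
    rw [sum_rot (fun n => c (rot^[i] n)), ih]

/-- The number of indices `i < 13` for which the `i`-th rotation of `n` lies in `J`. -/
def orbitCount (J : Finset ℕ) (n : ℕ) : ℕ :=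
  ∑ i ∈ Finset.range 13, (decide (rot^[i] n ∈ J)).toNat

lemma sum_orbitCount {J : Finset ℕ} (hJ : J ⊆ Finset.range 8192) :
    ∑ n ∈ Finset.range 8192, orbitCount J n = 13 * J.card := by
  simp only [orbitCount]
  rw [Finset.sum_comm]
  simp only [sum_rot_iterate (fun n => (decide (n ∈ J)).toNat)]
  have : ∑ n ∈ Finset.range 8192, (decide (n ∈ J)).toNat = J.card := by
    rw [Finset.card_eq_sum_ones, ← Finset.inter_eq_right.2 hJ, ← Finset.filter_mem_eq_inter,
      Finset.sum_filter]
    refine Finset.sum_congr rfl fun n hn => ?_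
    by_cases h : n ∈ J <;> simp_all
  simp [this]

lemma rot_ne_self {n : ℕ} (hn : 0 < n ∧ n < 8191) :
    rot n ≠ n ∧ 0 < rot n ∧ rot n < 8191 := by
  unfold rot; omega

lemma rot_iterate_bounds {n : ℕ} (hn : 0 < n ∧ n < 8191) (i : ℕ) :
    0 < rot^[i] n ∧ rot^[i] n < 8191 := by
  induction i with
  | zero => exact hn
  | succ i ih => rw [Function.iterate_succ_apply']; exact (rot_ne_self ih).2

lemma not_mem_rot_succ {J : Finset ℕ} (hI : CodeIndep J) {n : ℕ} (hn : 0 < n ∧ n < 8191)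
    (i : ℕ) : ¬ (rot^[i] n ∈ J ∧ rot^[i + 1] n ∈ J) := by
  rintro ⟨h1, h2⟩
  have hb := rot_iterate_bounds hn i
  rw [Function.iterate_succ_apply'] at h2
  generalize rot^[i] n = m at *
  refine hI _ h1 _ h2 (rot_ne_self hb).1.symm ?_
  unfold rot; omega

/-- An upper bound for `orbitCount`. -/
def orbitBound (n : ℕ) : ℕ := if 0 < n ∧ n < 8191 then 6 else 13

lemma orbitCount_le {J : Finset ℕ} (hI : CodeIndep J) {n : ℕ} (hn : n < 8192) :
    orbitCount J n ≤ orbitBound n := by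
  unfold orbitBound
  split_ifs with h
  · set x : ℕ → ℕ := fun i => (decide (rot^[i] n ∈ J)).toNat with hx
    have key : ∀ i, x i + x (i + 1) ≤ 1 := by
      intro i
      have := not_mem_rot_succ hI h i
      by_cases h1 : rot^[i] n ∈ J <;> by_cases h2 : rot^[i + 1] n ∈ J <;> simp_all
    have h13 : x 13 = x 0 := by simp only [hx]; rw [rot_iterate_period hn]; rfl
    have hs := Finset.sum_le_sum fun i (_ : i ∈ Finset.range 13) => key i
    rw [Finset.sum_add_distrib] at hs
    have h0 := Finset.sum_range_succ' x 13
    have h1 := Finset.sum_range_succ x 13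
    have hc : orbitCount J n = ∑ i ∈ Finset.range 13, x i := rfl
    simp only [Finset.sum_const, Finset.card_range, smul_eq_mul] at hs
    omega
  · calc orbitCount J n ≤ ∑ i ∈ Finset.range 13, 1 :=
        Finset.sum_le_sum fun i _ => Bool.toNat_le _
      _ = 13 := by simp

lemma sum_orbitBound : ∑ n ∈ Finset.range 8192, orbitBound n = 13 * 3782 := by
  rw [Finset.sum_range_succ, Finset.sum_range_succ']
  rw [Finset.sum_congr rfl (g := fun _ => 6)]
  · simp [orbitBound]
  · intro n hn
    simp only [Finset.mem_range] at hn
    simp only [orbitBound]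
    rw [if_pos (by omega)]

lemma orbitCount_eq {J : Finset ℕ} (hJ : J ⊆ Finset.range 8192) (hI : CodeIndep J)
    (hc : 3782 ≤ J.card) {n : ℕ} (hn : n < 8192) : orbitCount J n = orbitBound n := by
  have hle : ∀ m ∈ Finset.range 8192, orbitCount J m ≤ orbitBound m := fun m hm =>
    orbitCount_le hI (Finset.mem_range.1 hm)
  refine (Finset.sum_eq_sum_iff_of_le hle).1 (le_antisymm (Finset.sum_le_sum hle) ?_) n
    (Finset.mem_range.2 hn)
  rw [sum_orbitCount hJ, sum_orbitBound]
  omega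

/-- The alternating half of the rotation class of `w` that starts after the rotation by `t`. -/
def alternating (w t : ℕ) : List ℕ := (List.range 6).map fun k => rot^[(t + 1 + 2 * k) % 13] w

set_option synthInstance.maxSize 2000 in
set_option synthInstance.maxHeartbeats 400000 in
lemma exists_alternating_of_cyclic : ∀ x0 x1 : Bool, ¬ (x0 ∧ x1) → ∀ x2 : Bool, ¬ (x1 ∧ x2) →
    ∀ x3 : Bool, ¬ (x2 ∧ x3) → ∀ x4 : Bool, ¬ (x3 ∧ x4) → ∀ x5 : Bool, ¬ (x4 ∧ x5) →
    ∀ x6 : Bool, ¬ (x5 ∧ x6) → ∀ x7 : Bool, ¬ (x6 ∧ x7) → ∀ x8 : Bool, ¬ (x7 ∧ x8) →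
    ∀ x9 : Bool, ¬ (x8 ∧ x9) → ∀ x10 : Bool, ¬ (x9 ∧ x10) → ∀ x11 : Bool, ¬ (x10 ∧ x11) →
    ∀ x12 : Bool, ¬ (x11 ∧ x12) → ¬ (x12 ∧ x0) →
    ([x0, x1, x2, x3, x4, x5, x6, x7, x8, x9, x10, x11, x12].map Bool.toNat).sum = 6 →
    ∃ t ∈ List.range 13, ∀ k ∈ List.range 6,
      [x0, x1, x2, x3, x4, x5, x6, x7, x8, x9, x10, x11, x12].getD ((t + 1 + 2 * k) % 13) false
        = true := by
  decide +kernel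

lemma exists_alternating_subset {J : Finset ℕ} (hJ : J ⊆ Finset.range 8192)
    (hI : CodeIndep J) (hc : 3782 ≤ J.card) {w : ℕ} (hw : 0 < w ∧ w < 8191) :
    ∃ A ∈ (List.range 13).map (alternating w), ∀ a ∈ A, a ∈ J := by
  have hn := not_mem_rot_succ hI hw
  have h6 := orbitCount_eq hJ hI hc (n := w) (by omega)
  rw [orbitBound, if_pos hw] at h6
  set x : ℕ → Bool := fun i => decide (rot^[i] w ∈ J) with hx
  have hn' : ∀ i, ¬ (x i = true ∧ x (i + 1) = true) := by
    simpa only [hx, decide_eq_true_eq] using hn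
  have h13 : x 13 = x 0 := by simp only [hx]; rw [rot_iterate_period (by omega)]; rfl
  obtain ⟨t, ht, hk⟩ := exists_alternating_of_cyclic (x 0) (x 1) (hn' 0) (x 2) (hn' 1) (x 3)
    (hn' 2) (x 4) (hn' 3) (x 5) (hn' 4) (x 6) (hn' 5) (x 7) (hn' 6) (x 8) (hn' 7) (x 9) (hn' 8)
    (x 10) (hn' 9) (x 11) (hn' 10) (x 12) (hn' 11) (by rw [← h13]; exact hn' 12) h6
  refine ⟨_, List.mem_map_of_mem ht, ?_⟩
  intro a ha
  obtain ⟨k, hkr, rfl⟩ := List.mem_map.1 ha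
  have hlist : [x 0, x 1, x 2, x 3, x 4, x 5, x 6, x 7, x 8, x 9, x 10, x 11, x 12]
      = (List.range 13).map x := rfl
  have h := hk k hkr
  rw [hlist] at h
  have hlt : (t + 1 + 2 * k) % 13 < 13 := Nat.mod_lt _ (by norm_num)
  simpa [List.getD_eq_getElem?_getD, List.getElem?_range hlt, hx] using h

/-- No word of `A` is adjacent to a word of `B`. -/
def compatible (A B : List ℕ) : Bool :=
  A.all fun a => B.all fun b => a == b || (b % 4096 != a / 2 && a % 4096 != b / 2)

lemma CodeIndep.compatible {J : Finset ℕ} (hI : CodeIndep J) {A B : List ℕ}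
    (hA : ∀ a ∈ A, a ∈ J) (hB : ∀ b ∈ B, b ∈ J) : compatible A B = true := by
  simp only [DeBruijn.compatible, List.all_eq_true, Bool.or_eq_true, beq_iff_eq,
    Bool.and_eq_true, bne_iff_ne]
  intro a ha b hb
  by_cases h : a = b
  · exact Or.inl h
  · exact Or.inr ⟨hI a (hA a ha) b (hB b hb) h, hI b (hB b hb) a (hA a ha) (Ne.symm h)⟩

/-- The members of `L` compatible with some member of `P`. -/
def propagate (P L : List (List ℕ)) : List (List ℕ) :=
  L.filter fun B => P.any fun A => compatible A B

lemma CodeIndep.exists_mem_foldl_propagate {J : Finset ℕ} (hI : CodeIndep J)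
    (C : List (List (List ℕ))) (hC : ∀ L ∈ C, ∃ A ∈ L, ∀ a ∈ A, a ∈ J) (P : List (List ℕ))
    (hP : ∃ A ∈ P, ∀ a ∈ A, a ∈ J) : ∃ A ∈ C.foldl propagate P, ∀ a ∈ A, a ∈ J := by
  induction C generalizing P with
  | nil => exact hP
  | cons L C ih =>
    refine ih (fun L' h => hC L' (List.mem_cons_of_mem _ h)) _ ?_
    obtain ⟨A, hA, hAJ⟩ := hP
    obtain ⟨B, hB, hBJ⟩ := hC L List.mem_cons_self
    exact ⟨B, List.mem_filter.2 ⟨hB, List.any_eq_true.2 ⟨A, hA, hI.compatible hAJ hBJ⟩⟩, hBJ⟩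

/-- Codes of words of weights `1, …, 12`, each obtained from the previous one by changing one
letter up to rotation: in binary `1, 101, 10101, …, 10101010101`, followed by
`101010101011, 101010101111, …, 111111111111`. -/
def chain : List ℕ :=
  [1, 5, 21, 85, 341, 1365, 2731, 2735, 2751, 2815, 3071, 4095]

lemma foldl_propagate_chain :
    (chain.map (fun w => (List.range 13).map (alternating w)) ++ [[[8191]]]).foldl propagate
      [[0]] = [] := by
  decide +kernel

lemma card_le {J : Finset ℕ} (hJ : J ⊆ Finset.range 8192) (hI : CodeIndep J) :
    J.card ≤ 3781 := by
  by_contra! hc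
  have hfix : ∀ n < 8192, rot n = n → n ∈ J := by
    intro n hn hr
    have h := orbitCount_eq hJ hI hc hn
    by_contra hnJ
    have hb : ¬ (0 < n ∧ n < 8191) := fun h => (rot_ne_self h).1 hr
    simp [orbitCount, orbitBound, Function.iterate_fixed hr, hnJ, hb] at h
  obtain ⟨A, hA, -⟩ := hI.exists_mem_foldl_propagate
    (chain.map (fun w => (List.range 13).map (alternating w)) ++ [[[8191]]]) (by
      intro L hL
      rcases List.mem_append.1 hL with hL | hL
      · obtain ⟨w, hw, rfl⟩ := List.mem_map.1 hL
        have hb : ∀ w ∈ chain, 0 < w ∧ w < 8191 := by decide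
        exact exists_alternating_subset hJ hI hc (hb w hw)
      · obtain rfl := List.mem_singleton.1 hL
        exact ⟨[8191], by simp, by simpa using hfix 8191 (by norm_num) rfl⟩)
    [[0]] ⟨[0], by simp, by simpa using hfix 0 (by norm_num) rfl⟩
  rw [foldl_propagate_chain] at hA
  exact List.not_mem_nil hA

lemma IsIndep.card_le {I : Finset (Fin 13 → Fin 2)} (hI : IsIndep 13 2 I) :
    I.card ≤ 3781 := by
  rw [← Finset.card_image_of_injective I code_injective]
  apply DeBruijn.card_le
  · intro n hn
    obtain ⟨u, -, rfl⟩ := Finset.mem_image.1 hn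
    exact Finset.mem_range.2 (code_lt u)
  · intro a ha b hb hab h
    obtain ⟨u, hu, rfl⟩ := Finset.mem_image.1 ha
    obtain ⟨v, hv, rfl⟩ := Finset.mem_image.1 hb
    exact hI u hu v hv ⟨fun e => hab (congrArg code e), Or.inl ((shifts_iff u v).2 h)⟩

/-- The indicator bits of the codes of a maximum independent set of words. -/
def maxMask : ℕ :=
  5134512309728446287597228349878624908602412587743163016491997833792578309989755779027833555429701872094051273286940964754653037192437884572361024583074410275031666731460387436888494215721182194488048642651269701621525475477811268475489249544874905986413440678397794203901391789197633101210646996032336193832062829343308370295403257597301682085567369097050310582334167377039758280735235962422770590347902522726931057386471430552864061207210032797949120536108175204494339667930666792109142213072335433580457911521822069608311261578306099863808178420483635858107692908765847895462322088408427111524599725753408329230054033448985781259448660215609970360988257275714068435459161499132440638729234487401453388549190513329408576489262614602851520634738151034790363044145035632047309021875799179062086571179281132218575779616246223215131427986170367610481942676715562664625651543733989891887272574256988911354210441150666704898059320573575535411014286969206619613365399197290225590690287699673163704470948295898923083469289191281297722650942085281631196579433041554435304196579823760863653932937339306691599002253978599319524300555187625151852015517153171831072407909744063374853292372069632224975359457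2817850412829569377516372725587740867855258036832534736995854672535676188276741836895681439702151650365865816197662481742827329739477467734668955742068339237455895428020650571410173652164906311171131845948697660628053681845061577447572131402090135335973609264429672268359506968034499129570684532876813821003282442243599511075419410839822289706565457733662598707583894815226569335718379099328578436630006813509016817604134791986359323415627470341397663785875523902520908589385147078703537815359092926399705863906607585599280441863492120387158658465654671369490447821280741638078688861716579753352380279613004375501553609685790312011948251719942866747551670321706796824325271150431414778344157548763067439807364621626726244571665915248867887091694670588022935418530357259095438282404132445479902130074100545454750440273798604870464171715906888420764244336971985363303986249173673176742281569179674814738208556766946762176627104792567934145927425437176114031062679423786299099929702695688585351904623273085285511698869735235775972326193573021181843379237784624244219001663182639261769701863728534818358921109532186808315337964421554255344001537349276809872951022050253711619250136660976643442051032864100494379194884755124070755019002655712742514449861405915744213884010253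

lemma maxMask_indep {a : ℕ} (ha : a < 8192) (h : maxMask.testBit a = true) {b : ℕ}
    (hb : b < 8192) (hab : a ≠ b) (hs : b % 4096 = a / 2) : maxMask.testBit b = false := by
  have hall : allFrom (fun a => !maxMask.testBit a ||
      ((a == a / 2 || !maxMask.testBit (a / 2)) &&
        (a == a / 2 + 4096 || !maxMask.testBit (a / 2 + 4096)))) 13 0 = true := by
    decide +kernel
  have hp := of_allFrom _ 13 0 a hall (by omega) (by omega)
  simp only [h, Bool.not_true, Bool.false_or, Bool.and_eq_true, Bool.or_eq_true, beq_iff_eq,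
    Bool.not_eq_true'] at hp
  have hcase : b = a / 2 ∨ b = a / 2 + 4096 := by omega
  rcases hcase with rfl | rfl
  · exact hp.1.resolve_left hab
  · exact hp.2.resolve_left hab

/-- The independent set of words with indicator bits `maxMask`. -/
def maxSet : Finset (Fin 13 → Fin 2) :=
  Finset.univ.filter fun u => maxMask.testBit (code u) = true

lemma mem_maxSet {u : Fin 13 → Fin 2} : u ∈ maxSet ↔ maxMask.testBit (code u) = true := by
  simp [maxSet]

lemma isIndep_maxSet : IsIndep 13 2 maxSet := by
  have key : ∀ u ∈ maxSet, ∀ v ∈ maxSet, u ≠ v → ¬ shifts 13 2 u v := by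
    intro u hu v hv huv h
    have := maxMask_indep (code_lt u) (mem_maxSet.1 hu) (code_lt v)
      (code_injective.ne huv) ((shifts_iff u v).1 h)
    rw [mem_maxSet.1 hv] at this
    exact Bool.noConfusion this
  rintro u hu v hv ⟨huv, h | h⟩
  · exact key u hu v hv huv h
  · exact key v hv u hu huv.symm h

lemma card_maxSet : maxSet.card = 3781 := by
  have himage : maxSet.image code =
      (Finset.range 8192).filter fun n => maxMask.testBit n = true := by
    ext n
    simp only [Finset.mem_image, mem_maxSet, Finset.mem_filter, Finset.mem_range]
    constructor
    · rintro ⟨u, hu, rfl⟩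
      exact ⟨code_lt u, hu⟩
    · rintro ⟨hn, h⟩
      obtain ⟨u, rfl⟩ := exists_code_eq hn
      exact ⟨u, h, rfl⟩
  have hcount : countFrom maxMask.testBit 13 0 = 3781 := by decide +kernel
  rw [← Finset.card_image_of_injective _ code_injective, himage, Finset.card_filter, ← hcount,
    countFrom_eq_sum]
  refine Finset.sum_congr rfl fun n _ => ?_
  rw [zero_add]
  cases maxMask.testBit n <;> rfl

lemma code_zero : code (fun _ => 0) = 0 := by
  rw [code, finFunctionFinEquiv_apply]; simp

lemma code_one : code (fun _ => 1) = 8191 := by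
  rw [code, finFunctionFinEquiv_apply]; simp [Fin.sum_univ_succ]

end DeBruijn

/-- α(13,2) = 3781, attained by an independent set containing
the constant word 0^13 and excluding the constant word 1^13. -/
theorem alpha_thirteen_two :
    alphaDB 13 2 = 3781 ∧
    ∃ I : Finset (Fin 13 → Fin 2), IsIndep 13 2 I ∧ I.card = 3781 ∧
      (fun _ => (0 : Fin 2)) ∈ I ∧ (fun _ => (1 : Fin 2)) ∉ I := by
  refine ⟨IsGreatest.csSup_eq ⟨⟨_, DeBruijn.isIndep_maxSet, DeBruijn.card_maxSet⟩, ?_⟩,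
    DeBruijn.maxSet, DeBruijn.isIndep_maxSet, DeBruijn.card_maxSet, ?_, ?_⟩
  · rintro n ⟨I, hI, rfl⟩
    exact DeBruijn.IsIndep.card_le hI
  · rw [DeBruijn.mem_maxSet, DeBruijn.code_zero]
    decide +kernel
  · rw [DeBruijn.mem_maxSet, DeBruijn.code_one]
    decide +kernel
end
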